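/- For all indices j, k with 1 ≤ j, k ≤ L−1 and every (t,α) ∈ ℝ × ℝ^{L−1}, the Christoffel symbol Γ^k_{0j}(t,α) equals p_j'(t) p_k(t) B(t) / (N(t) B(t) + A(t,α)²). -/

import Mathlib

/-!
Formalization of results from "A geometric approach to equilibrium selection":
the metric, Christoffel symbols and curvature of the equilibrium manifold of a
two-consumer exchange economy with `L` goods, parametrized by
`Φ(t,α) = (p_1(t),…,p_{L−1}(t), α_1,…,α_{L−1}, w(t) − Σ_m p_m(t) α_m)`.

Indices run over `Fin L`, where the index `0` corresponds to the coordinate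
`x_0 = t` and an index `i ≠ 0` corresponds to the coordinate `x_i = α_i`
(the component `α 0` of `α : Fin L → ℝ` is never used, so `α` is just a copy
of `ℝ^{L−1}` together with an irrelevant extra coordinate).
-/

open Matrix BigOperators

noncomputable section

namespace EqSelection

variable {L : ℕ}

/-- `A(t,α) = w'(t) − Σ_{m=1}^{L−1} p_m'(t) α_m`. -/
def eqA [NeZero L] (p : Fin L → ℝ → ℝ) (w : ℝ → ℝ) (t : ℝ) (α : Fin L → ℝ) : ℝ :=
  deriv w t - ∑ m ∈ Finset.univ \ {0}, deriv (p m) t * α m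

/-- `A'(t,α) = w''(t) − Σ_{m=1}^{L−1} p_m''(t) α_m`. -/
def eqA' [NeZero L] (p : Fin L → ℝ → ℝ) (w : ℝ → ℝ) (t : ℝ) (α : Fin L → ℝ) : ℝ :=
  deriv (deriv w) t - ∑ m ∈ Finset.univ \ {0}, deriv (deriv (p m)) t * α m

/-- `B(t) = Σ_{m=1}^{L−1} (p_m'(t))²`. -/
def eqB [NeZero L] (p : Fin L → ℝ → ℝ) (t : ℝ) : ℝ :=
  ∑ m ∈ Finset.univ \ {0}, (deriv (p m) t) ^ 2

/-- `N(t) = 1 + Σ_{m=1}^{L−1} (p_m(t))²`. -/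
def eqN [NeZero L] (p : Fin L → ℝ → ℝ) (t : ℝ) : ℝ :=
  1 + ∑ m ∈ Finset.univ \ {0}, (p m t) ^ 2

/-- `C(t) = Σ_{m=1}^{L−1} p_m'(t) p_m''(t)`. -/
def eqC [NeZero L] (p : Fin L → ℝ → ℝ) (t : ℝ) : ℝ :=
  ∑ m ∈ Finset.univ \ {0}, deriv (p m) t * deriv (deriv (p m)) t

/-- `P(t) = Σ_{m=1}^{L−1} p_m(t) p_m'(t)`. -/
def eqP [NeZero L] (p : Fin L → ℝ → ℝ) (t : ℝ) : ℝ :=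
  ∑ m ∈ Finset.univ \ {0}, p m t * deriv (p m) t

/-- The induced metric matrix `g(t,α)`: `g_{00} = B + A²`, `g_{0i} = g_{i0} = −p_i A`,
`g_{ij} = p_i p_j + δ_{ij}` for `i, j ≠ 0`. -/
def gMat [NeZero L] (p : Fin L → ℝ → ℝ) (w : ℝ → ℝ) (t : ℝ) (α : Fin L → ℝ) :
    Matrix (Fin L) (Fin L) ℝ :=
  Matrix.of fun i j =>
    if i = 0 then
      if j = 0 then eqB p t + (eqA p w t α) ^ 2 else -(p j t) * eqA p w t α
    else
      if j = 0 then -(p i t) * eqA p w t α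
      else p i t * p j t + (if i = j then 1 else 0)

/-- Partial derivative with respect to the coordinate `x_k`, where `x_0 = t`
and `x_i = α_i` for `i ≠ 0`. -/
def pder [NeZero L] (k : Fin L) (f : ℝ → (Fin L → ℝ) → ℝ) (t : ℝ) (α : Fin L → ℝ) : ℝ :=
  if k = 0 then deriv (fun s => f s α) t
  else deriv (fun s => f t (Function.update α k s)) (α k)

/-- Christoffel symbol
`Γ^k_{ij} = (1/2) Σ_{h=0}^{L−1} g^{hk} (∂g_{jh}/∂x_i + ∂g_{hi}/∂x_j − ∂g_{ij}/∂x_h)`,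
written `christoffel p w i j k`.  (Here `g^{hk}` denotes the entries of the inverse
matrix of `g`, i.e. of `(gMat p w t α)⁻¹`.) -/
def christoffel [NeZero L] (p : Fin L → ℝ → ℝ) (w : ℝ → ℝ) (i j k : Fin L)
    (t : ℝ) (α : Fin L → ℝ) : ℝ :=
  (1 / 2) * ∑ h : Fin L,
    (gMat p w t α)⁻¹ h k *
      (pder i (fun t' α' => gMat p w t' α' j h) t α
        + pder j (fun t' α' => gMat p w t' α' h i) t α
        - pder h (fun t' α' => gMat p w t' α' i j) t α)

/-- Curvature coefficient
`R^s_{ijk} = Σ_{m} Γ^m_{ik} Γ^s_{jm} − Σ_{m} Γ^m_{jk} Γ^s_{im} + ∂Γ^s_{ik}/∂x_j − ∂Γ^s_{jk}/∂x_i`,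
written `curvR p w i j k s`. -/
def curvR [NeZero L] (p : Fin L → ℝ → ℝ) (w : ℝ → ℝ) (i j k s : Fin L)
    (t : ℝ) (α : Fin L → ℝ) : ℝ :=
  (∑ m : Fin L, christoffel p w i k m t α * christoffel p w j m s t α)
    - (∑ m : Fin L, christoffel p w j k m t α * christoffel p w i m s t α)
    + pder j (christoffel p w i k s) t α - pder i (christoffel p w j k s) t α

/-- The coordinate tangent vectors `Φ_i(t,α) ∈ ℝ^{2L−1}` of the parametrization
`Φ(t,α) = (p_1(t),…,p_{L−1}(t), α_1,…,α_{L−1}, w(t) − Σ_m p_m(t) α_m)`: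
`Φ_0 = (p_1',…,p_{L−1}', 0,…,0, A)`, and for `i ≠ 0` the vector `Φ_i` has entry `1`
in position `(L−1)+i` (1-indexed), entry `−p_i` in the last position and `0` elsewhere. -/
def PhiVec [NeZero L] (p : Fin L → ℝ → ℝ) (w : ℝ → ℝ) (i : Fin L)
    (t : ℝ) (α : Fin L → ℝ) : Fin (2 * L - 1) → ℝ :=
  fun j =>
    if i = 0 then
      if h : (j : ℕ) < L - 1 then deriv (p ⟨(j : ℕ) + 1, by omega⟩) t
      else if (j : ℕ) = 2 * L - 2 then eqA p w t α else 0
    else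
      if (j : ℕ) + 1 = (L - 1) + (i : ℕ) then 1
      else if (j : ℕ) = 2 * L - 2 then -(p i t) else 0

/-- The matrix `M(t,α)` of Statement 2: `M_{00} = N`, `M_{0i} = M_{i0} = p_i A`,
`M_{ii} = (N − p_i²) B + A²`, `M_{ij} = −p_i p_j B` for `i ≠ j`, `i, j ≠ 0`. -/
def invNumer [NeZero L] (p : Fin L → ℝ → ℝ) (w : ℝ → ℝ) (t : ℝ) (α : Fin L → ℝ) :
    Matrix (Fin L) (Fin L) ℝ :=
  Matrix.of fun i j =>
    if i = 0 then
      if j = 0 then eqN p t else p j t * eqA p w t α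
    else
      if j = 0 then p i t * eqA p w t α
      else if i = j then (eqN p t - (p i t) ^ 2) * eqB p t + (eqA p w t α) ^ 2
      else -(p i t * p j t * eqB p t)

theorem sum_univ_eq_zero_add [NeZero L] (f : Fin L → ℝ) :
    ∑ h, f h = f 0 + ∑ h ∈ Finset.univ \ {0}, f h :=
  Finset.sum_eq_add_sum_sdiff_singleton_of_mem (Finset.mem_univ 0) f

theorem sum_ne_zero_sq [NeZero L] (p : Fin L → ℝ → ℝ) (t : ℝ) :
    ∑ m ∈ Finset.univ \ {0}, (p m t) ^ 2 = eqN p t - 1 := by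
  simp [eqN]

/-- A sum of a rank-one term and a diagonal term over the nonzero indices. -/
theorem sum_ne_zero_mul_add_ite [NeZero L] (p : Fin L → ℝ → ℝ) (t a b : ℝ)
    {k : Fin L} (hk : k ≠ 0) :
    ∑ h ∈ Finset.univ \ {0}, p h t * (p h t * a + if h = k then b else 0)
      = (eqN p t - 1) * a + p k t * b := by
  have hmem : k ∈ Finset.univ \ {(0 : Fin L)} := by simpa using hk
  simp only [mul_add, mul_ite, mul_zero, Finset.sum_add_distrib, Finset.sum_ite_eq', hmem,
    if_true]
  rw [← sum_ne_zero_sq, Finset.sum_mul]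
  congr 1
  exact Finset.sum_congr rfl fun _ _ => by ring

theorem eqN_mul_eqB_add_sq_pos [NeZero L] (p : Fin L → ℝ → ℝ) (w : ℝ → ℝ) (t : ℝ)
    (hreg : 0 < eqB p t ∨ deriv w t ≠ 0) (α : Fin L → ℝ) :
    0 < eqN p t * eqB p t + (eqA p w t α) ^ 2 := by
  have hN : 0 < eqN p t := by unfold eqN; positivity
  have hB : 0 ≤ eqB p t := by unfold eqB; positivity
  rcases hB.lt_or_eq with hB | hB
  · positivity
  · have hw : deriv w t ≠ 0 := hreg.resolve_left (by simp [← hB])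
    have hp : ∀ m ∈ Finset.univ \ {(0 : Fin L)}, (deriv (p m) t) ^ 2 = 0 :=
      (Finset.sum_eq_zero_iff_of_nonneg fun _ _ => sq_nonneg _).1 hB.symm
    have hA : eqA p w t α = deriv w t := by
      rw [eqA, Finset.sum_eq_zero, sub_zero]
      intro m hm
      rw [pow_eq_zero_iff two_ne_zero |>.1 (hp m hm), zero_mul]
    rw [hA, ← hB]
    positivity

theorem invNumer_of_ne_zero [NeZero L] (p : Fin L → ℝ → ℝ) (w : ℝ → ℝ) (t : ℝ)
    (α : Fin L → ℝ) {h k : Fin L} (hh : h ≠ 0) (hk : k ≠ 0) :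
    invNumer p w t α h k = p h t * (-(p k t * eqB p t))
      + if h = k then eqN p t * eqB p t + (eqA p w t α) ^ 2 else 0 := by
  by_cases hhk : h = k
  · subst hhk
    simp only [invNumer, Matrix.of_apply, hh, if_false, if_true]
    ring
  · simp only [invNumer, Matrix.of_apply, hh, hk, hhk, if_false]
    ring

theorem gMat_mul_invNumer [NeZero L] (p : Fin L → ℝ → ℝ) (w : ℝ → ℝ) (t : ℝ)
    (α : Fin L → ℝ) :
    gMat p w t α * invNumer p w t α
      = (eqN p t * eqB p t + (eqA p w t α) ^ 2) • (1 : Matrix (Fin L) (Fin L) ℝ) := by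
  have hne : ∀ h ∈ Finset.univ \ {(0 : Fin L)}, h ≠ 0 := by simp
  ext i k
  rw [Matrix.mul_apply, sum_univ_eq_zero_add, Matrix.smul_apply, Matrix.one_apply, smul_eq_mul]
  by_cases hi : i = 0 <;> by_cases hk : k = 0
  · subst hi hk
    have hs : ∑ h ∈ Finset.univ \ {(0 : Fin L)}, gMat p w t α 0 h * invNumer p w t α h 0
        = (eqN p t - 1) * (-(eqA p w t α) ^ 2) := by
      rw [← sum_ne_zero_sq, Finset.sum_mul]
      refine Finset.sum_congr rfl fun h hh => ?_
      simp only [gMat, invNumer, Matrix.of_apply, hne h hh, if_false, if_true]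
      ring
    rw [hs]
    simp only [gMat, invNumer, Matrix.of_apply, if_true]
    ring
  · subst hi
    have hs : ∑ h ∈ Finset.univ \ {(0 : Fin L)}, gMat p w t α 0 h * invNumer p w t α h k
        = -eqA p w t α * ((eqN p t - 1) * (-(p k t * eqB p t))
          + p k t * (eqN p t * eqB p t + (eqA p w t α) ^ 2)) := by
      rw [← sum_ne_zero_mul_add_ite p t _ _ hk, Finset.mul_sum]
      refine Finset.sum_congr rfl fun h hh => ?_
      rw [invNumer_of_ne_zero p w t α (hne h hh) hk]
      simp only [gMat, Matrix.of_apply, hne h hh, if_false, if_true]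
      ring
    rw [hs]
    simp only [gMat, invNumer, Matrix.of_apply, hk, Ne.symm hk, if_true, if_false]
    ring
  · subst hk
    have hs : ∑ h ∈ Finset.univ \ {(0 : Fin L)}, gMat p w t α i h * invNumer p w t α h 0
        = eqA p w t α * ((eqN p t - 1) * p i t + p i t * 1) := by
      rw [← sum_ne_zero_mul_add_ite p t _ _ hi, Finset.mul_sum]
      refine Finset.sum_congr rfl fun h hh => ?_
      simp only [gMat, invNumer, Matrix.of_apply, hi, hne h hh, if_false, if_true,
        eq_comm (a := i)]
      ring
    rw [hs]
    simp only [gMat, invNumer, Matrix.of_apply, hi, if_true, if_false]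
    ring
  · have hmem : i ∈ Finset.univ \ {(0 : Fin L)} := by simpa using hi
    have hs : ∑ h ∈ Finset.univ \ {(0 : Fin L)}, gMat p w t α i h * invNumer p w t α h k
        = p i t * ((eqN p t - 1) * (-(p k t * eqB p t))
          + p k t * (eqN p t * eqB p t + (eqA p w t α) ^ 2)) + invNumer p w t α i k := by
      have hδ : invNumer p w t α i k = ∑ h ∈ Finset.univ \ {(0 : Fin L)},
          if i = h then invNumer p w t α h k else 0 := by
        simp only [Finset.sum_ite_eq, hmem, if_true]
      rw [← sum_ne_zero_mul_add_ite p t _ _ hk, hδ, Finset.mul_sum, ← Finset.sum_add_distrib]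
      refine Finset.sum_congr rfl fun h hh => ?_
      rw [← invNumer_of_ne_zero p w t α (hne h hh) hk]
      simp only [gMat, Matrix.of_apply, hi, hne h hh, if_false]
      split_ifs <;> ring
    rw [hs, invNumer_of_ne_zero p w t α hi hk]
    simp only [gMat, invNumer, Matrix.of_apply, hi, hk, if_true, if_false]
    split_ifs <;> ring

theorem gMat_inv_apply [NeZero L] (p : Fin L → ℝ → ℝ) (w : ℝ → ℝ) (t : ℝ)
    (α : Fin L → ℝ) (hD : eqN p t * eqB p t + (eqA p w t α) ^ 2 ≠ 0) (h k : Fin L) :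
    (gMat p w t α)⁻¹ h k
      = invNumer p w t α h k / (eqN p t * eqB p t + (eqA p w t α) ^ 2) := by
  have hinv : (gMat p w t α)⁻¹
      = (eqN p t * eqB p t + (eqA p w t α) ^ 2)⁻¹ • invNumer p w t α := by
    refine Matrix.inv_eq_right_inv ?_
    rw [Matrix.mul_smul, gMat_mul_invNumer, smul_smul, inv_mul_cancel₀ hD, one_smul]
  rw [hinv, Matrix.smul_apply, smul_eq_mul, div_eq_inv_mul]

theorem hasDerivAt_eqA_update [NeZero L] (p : Fin L → ℝ → ℝ) (w : ℝ → ℝ) (t : ℝ)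
    (α : Fin L → ℝ) {k : Fin L} (hk : k ≠ 0) (s : ℝ) :
    HasDerivAt (fun s => eqA p w t (Function.update α k s)) (-deriv (p k) t) s := by
  have hmem : k ∈ Finset.univ \ {(0 : Fin L)} := by simpa using hk
  have hterm : ∀ m ∈ Finset.univ \ {(0 : Fin L)},
      HasDerivAt (fun s => deriv (p m) t * Function.update α k s m)
        (if m = k then deriv (p m) t else 0) s := by
    intro m _
    by_cases hm : m = k
    · subst hm
      simpa using (hasDerivAt_id s).const_mul (deriv (p m) t)
    · simpa [hm] using hasDerivAt_const s (deriv (p m) t * α m)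
  have hsum := (HasDerivAt.fun_sum hterm).const_sub (deriv w t)
  simp only [Finset.sum_ite_eq', hmem, if_true] at hsum
  exact hsum

/-- Twice the Christoffel symbol of the first kind with lower indices `0`, `j`, and `h`. -/
theorem pder_gMat_combination [NeZero L] (p : Fin L → ℝ → ℝ) (w : ℝ → ℝ)
    (hp : ∀ i, Differentiable ℝ (p i)) {j : Fin L} (hj : j ≠ 0) (h : Fin L)
    (t : ℝ) (α : Fin L → ℝ) :
    pder 0 (fun t' α' => gMat p w t' α' j h) t α
        + pder j (fun t' α' => gMat p w t' α' h 0) t α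
        - pder h (fun t' α' => gMat p w t' α' 0 j) t α
      = 2 * deriv (p j) t * (if h = 0 then -eqA p w t α else p h t) := by
  have hA := hasDerivAt_eqA_update p w t α hj (α j)
  by_cases hh : h = 0
  · subst hh
    simp only [pder, gMat, Matrix.of_apply, hj, if_true, if_false]
    have hd := ((hA.fun_pow 2).const_add (eqB p t)).deriv
    rw [hd, Function.update_eq_self]
    push_cast
    ring
  · have hA' := hasDerivAt_eqA_update p w t α hh (α h)
    simp only [pder, gMat, Matrix.of_apply, hj, hh, if_true, if_false]
    have hd := (((hp j t).hasDerivAt.fun_mul (hp h t).hasDerivAt).add_const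
      (if j = h then (1 : ℝ) else 0)).deriv
    rw [hd, (hA.const_mul (-p h t)).deriv, (hA'.const_mul (-p j t)).deriv]
    ring

theorem statement_7 (L : ℕ) [NeZero L] (hL : 2 ≤ L)
    (p : Fin L → ℝ → ℝ) (w : ℝ → ℝ)
    (hp : ∀ i, ContDiff ℝ (⊤ : ℕ∞) (p i)) (hw : ContDiff ℝ (⊤ : ℕ∞) w)
    (hreg : ∀ t : ℝ, 0 < eqB p t ∨ deriv w t ≠ 0) :
    ∀ j k : Fin L, j ≠ 0 → k ≠ 0 →
      ∀ (t : ℝ) (α : Fin L → ℝ),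
        christoffel p w 0 j k t α
          = deriv (p j) t * p k t * eqB p t / (eqN p t * eqB p t + (eqA p w t α) ^ 2) := by
  intro j k hj hk t α
  have hD := (eqN_mul_eqB_add_sq_pos p w t (hreg t) α).ne'
  have hpd : ∀ i, Differentiable ℝ (p i) := fun i => (hp i).differentiable (by simp)
  have hne : ∀ h ∈ Finset.univ \ {(0 : Fin L)}, h ≠ 0 := by simp
  simp only [christoffel, pder_gMat_combination p w hpd hj, gMat_inv_apply p w t α hD]
  have hs : ∑ h ∈ Finset.univ \ {(0 : Fin L)},
      invNumer p w t α h k / (eqN p t * eqB p t + (eqA p w t α) ^ 2)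
        * (2 * deriv (p j) t * (if h = 0 then -eqA p w t α else p h t))
      = 2 * deriv (p j) t / (eqN p t * eqB p t + (eqA p w t α) ^ 2)
        * ((eqN p t - 1) * (-(p k t * eqB p t))
          + p k t * (eqN p t * eqB p t + (eqA p w t α) ^ 2)) := by
    rw [← sum_ne_zero_mul_add_ite p t _ _ hk, Finset.mul_sum]
    refine Finset.sum_congr rfl fun h hh => ?_
    rw [← invNumer_of_ne_zero p w t α (hne h hh) hk, if_neg (hne h hh)]
    ring
  rw [sum_univ_eq_zero_add, hs]
  simp only [invNumer, Matrix.of_apply, hk, if_true, if_false]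
  field_simp
  ring

end EqSelection
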